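/- Let d ≠ 0, 1 be a squarefree integer, K = ℚ(√d) with ring of integers 𝒪 and discriminant Δ (Δ = 4d if d ≡ 2, 3 (mod 4), Δ = d if d ≡ 1 (mod 4)), let 𝔭 ⊂ 𝒪 be a nonzero prime ideal with 𝔭 ∩ ℤ = pℤ for an odd prime p, and let G be a nontrivial finite abelian group with p ∤ exp(G). Suppose Δ does not divide exp(G). Then the following are equivalent: (i) the group ring 𝒪_𝔭[G] is feebly clean but not clean; (ii) the ring 𝒪_𝔭[x]/(Φ_{exp(G)}(x)) is feebly clean but not clean; (iii) one of the following holds: (a) φ(exp(G)) = 2·ord_{exp(G)}(p) and the Legendre symbol (Δ/p) equals 1 or 0; (b) ord_{exp(G)}(p) = φ(exp(G))/2 is odd and (Δ/p) = −1; (c) exp(G) ≠ 2, φ(exp(G)) = ord_{exp(G)}(p), and (Δ/p) = −1. -/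

import Mathlib

open NumberField

/-- A ring is *clean* if every element is the sum of a unit and an idempotent. -/
def IsCleanRing (R : Type*) [Ring R] : Prop :=
  ∀ r : R, ∃ u e : R, IsUnit u ∧ IsIdempotentElem e ∧ r = u + e

/-- A ring is *feebly clean* if every element can be written as `u + e₁ - e₂` with `u`
a unit and `e₁`, `e₂` orthogonal idempotents. -/
def IsFeeblyCleanRing (R : Type*) [Ring R] : Prop :=
  ∀ r : R, ∃ u e₁ e₂ : R, IsUnit u ∧ IsIdempotentElem e₁ ∧ IsIdempotentElem e₂ ∧
    e₁ * e₂ = 0 ∧ r = u + e₁ - e₂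

lemma IsCleanRing.of_surj {R S : Type*} [Ring R] [Ring S] (f : R →+* S)
    (hf : Function.Surjective f) (h : IsCleanRing R) : IsCleanRing S := by
  intro s
  obtain ⟨r, rfl⟩ := hf s
  obtain ⟨u, e, hu, he, rfl⟩ := h r
  exact ⟨f u, f e, hu.map f, he.map f, map_add _ _ _⟩

lemma IsFeeblyCleanRing.of_surj {R S : Type*} [Ring R] [Ring S] (f : R →+* S)
    (hf : Function.Surjective f) (h : IsFeeblyCleanRing R) : IsFeeblyCleanRing S := by
  intro s
  obtain ⟨r, rfl⟩ := hf s
  obtain ⟨u, e, e', hu, he, he', h0, rfl⟩ := h r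
  exact ⟨f u, f e, f e', hu.map f, he.map f, he'.map f, by rw [← map_mul, h0, map_zero], by simp⟩

lemma isUnit_of_forall_maximal {R : Type*} [CommRing R] (u : R)
    (h : ∀ M : Ideal R, M.IsMaximal → u ∉ M) : IsUnit u := by
  by_contra hu
  obtain ⟨M, hM, hm⟩ := exists_max_ideal_of_mem_nonunits hu
  exact h M hM hm

lemma idem_eq_zero_of_forall_maximal {R : Type*} [CommRing R] (e : R) (he : IsIdempotentElem e)
    (h : ∀ M : Ideal R, M.IsMaximal → e ∈ M) : e = 0 := by
  have : IsUnit (1 - e) := isUnit_of_forall_maximal _ fun M hM h1 => by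
    have := M.add_mem h1 (h M hM)
    rw [sub_add_cancel] at this
    exact hM.ne_top ((Ideal.eq_top_iff_one _).2 this)
  have h2 : (1 - e) * e = 0 := by rw [sub_mul, one_mul, he.eq, sub_self]
  exact (this.mul_right_eq_zero).1 h2

section Glue

variable {R ι : Type*} [CommRing R] (f : Ideal R → ι) (ε : ι → R)

lemma idem_prod (hε : ∀ i, IsIdempotentElem (ε i)) (S : Finset ι) :
    IsIdempotentElem (∏ i ∈ S, (1 - ε i)) := by
  unfold IsIdempotentElem
  rw [← Finset.prod_mul_distrib]
  exact Finset.prod_congr rfl fun i _ => (hε i).one_sub.eq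

lemma glue_idem (hε : ∀ i, IsIdempotentElem (ε i))
    (hM : ∀ M : Ideal R, M.IsMaximal → ∀ i, ε i ∈ M ↔ f M ≠ i) (S : Finset ι) :
    ∃ e : R, IsIdempotentElem e ∧ ∀ M : Ideal R, M.IsMaximal →
      (f M ∈ S → 1 - e ∈ M) ∧ (f M ∉ S → e ∈ M) := by
  refine ⟨1 - ∏ i ∈ S, (1 - ε i), (idem_prod ε hε S).one_sub, fun M hMm => ⟨fun hS => ?_,
    fun hS => ?_⟩⟩
  · rw [sub_sub_cancel]
    have := hMm.isPrime
    rw [Ideal.IsPrime.prod_mem_iff]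
    refine ⟨f M, hS, ?_⟩
    have h1 : ε (f M) * (1 - ε (f M)) ∈ M := by
      rw [mul_sub, mul_one, (hε _).eq, sub_self]; exact M.zero_mem
    exact (this.mem_or_mem h1).resolve_left fun h => (hM M hMm _).1 h rfl
  · rw [← Ideal.Quotient.eq_zero_iff_mem, map_sub, map_prod, map_one]
    rw [Finset.prod_eq_one, sub_self]
    intro i hi
    rw [map_sub, map_one, Ideal.Quotient.eq_zero_iff_mem.2 ((hM M hMm i).2 fun h => hS (h ▸ hi)),
      sub_zero]

lemma feeblyClean_glue [Finite ι] (h2 : IsUnit (2 : R)) (hε : ∀ i, IsIdempotentElem (ε i))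
    (hM : ∀ M : Ideal R, M.IsMaximal → ∀ i, ε i ∈ M ↔ f M ≠ i)
    (hfib : ∀ M₁ M₂ M₃ : Ideal R, M₁.IsMaximal → M₂.IsMaximal → M₃.IsMaximal →
      f M₁ = f M₂ → f M₁ = f M₃ → M₁ = M₂ ∨ M₁ = M₃ ∨ M₂ = M₃) : IsFeeblyCleanRing R := by
  classical
  have := Fintype.ofFinite ι
  intro r
  have one_nm : ∀ M : Ideal R, M.IsMaximal → (1 : R) ∉ M := fun M hM h =>
    hM.ne_top ((Ideal.eq_top_iff_one _).2 h)
  have two_nm : ∀ M : Ideal R, M.IsMaximal → (2 : R) ∉ M := fun M hM h =>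
    hM.ne_top (Ideal.eq_top_of_isUnit_mem _ h h2)
  have key : ∀ i, (∀ M : Ideal R, M.IsMaximal → f M = i → r ∉ M) ∨
      (∀ M : Ideal R, M.IsMaximal → f M = i → r - 1 ∉ M) ∨
      (∀ M : Ideal R, M.IsMaximal → f M = i → r + 1 ∉ M) := by
    intro i
    by_contra! h
    obtain ⟨⟨M₁, m1, e1, r1⟩, ⟨M₂, m2, e2, r2⟩, ⟨M₃, m3, e3, r3⟩⟩ := h
    rcases hfib M₁ M₂ M₃ m1 m2 m3 (e1.trans e2.symm) (e1.trans e3.symm) with rfl | rfl | rfl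
    · exact one_nm _ m1 (by simpa using sub_mem r1 r2)
    · exact one_nm _ m1 (by simpa using sub_mem r3 r1)
    · refine two_nm _ m2 ?_
      have := sub_mem r3 r2
      have h3 : r + 1 - (r - 1) = 2 := by ring
      rwa [h3] at this
  let S₁ : Finset ι := Finset.univ.filter fun i =>
    ¬ (∀ M : Ideal R, M.IsMaximal → f M = i → r ∉ M) ∧
      (∀ M : Ideal R, M.IsMaximal → f M = i → r - 1 ∉ M)
  let S₂ : Finset ι := Finset.univ.filter fun i =>
    ¬ (∀ M : Ideal R, M.IsMaximal → f M = i → r ∉ M) ∧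
      ¬ (∀ M : Ideal R, M.IsMaximal → f M = i → r - 1 ∉ M)
  obtain ⟨e₁, he₁, hM₁⟩ := glue_idem f ε hε hM S₁
  obtain ⟨e₂, he₂, hM₂⟩ := glue_idem f ε hε hM S₂
  have hdisj : ∀ i, i ∈ S₁ → i ∉ S₂ := by
    intro i h1 h2
    simp only [S₁, S₂, Finset.mem_filter] at h1 h2
    exact h2.2.2 h1.2.2
  refine ⟨r - e₁ + e₂, e₁, e₂, ?_, he₁, he₂, ?_, by ring⟩
  · refine isUnit_of_forall_maximal _ fun M hMm hmem => ?_
    by_cases h1 : f M ∈ S₁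
    · have a := (hM₁ M hMm).1 h1
      have b := (hM₂ M hMm).2 (hdisj _ h1)
      have hh := (Finset.mem_filter.1 h1).2.2 M hMm rfl
      apply hh
      have : r - 1 = (r - e₁ + e₂) - (1 - e₁) - e₂ := by ring
      rw [this]
      exact sub_mem (sub_mem hmem a) b
    · by_cases h2 : f M ∈ S₂
      · have a := (hM₁ M hMm).2 h1
        have b := (hM₂ M hMm).1 h2
        have hh := (Finset.mem_filter.1 h2).2
        have := ((key (f M)).resolve_left hh.1).resolve_left hh.2 M hMm rfl
        apply this
        have : r + 1 = (r - e₁ + e₂) + e₁ + (1 - e₂) := by ring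
        rw [this]
        exact add_mem (add_mem hmem a) b
      · have a := (hM₁ M hMm).2 h1
        have b := (hM₂ M hMm).2 h2
        have hh : (∀ M' : Ideal R, M'.IsMaximal → f M' = f M → r ∉ M') := by
          by_contra hc
          simp only [S₁, S₂, Finset.mem_filter, Finset.mem_univ, true_and] at h1 h2
          tauto
        apply hh M hMm rfl
        have : r = (r - e₁ + e₂) + e₁ - e₂ := by ring
        rw [this]
        exact sub_mem (add_mem hmem a) b
  · refine idem_eq_zero_of_forall_maximal _ (he₁.mul he₂) fun M hMm => ?_
    by_cases h1 : f M ∈ S₁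
    · exact M.mul_mem_left _ ((hM₂ M hMm).2 (hdisj _ h1))
    · exact M.mul_mem_right _ ((hM₁ M hMm).2 h1)

lemma clean_glue [Finite ι] (hε : ∀ i, IsIdempotentElem (ε i))
    (hM : ∀ M : Ideal R, M.IsMaximal → ∀ i, ε i ∈ M ↔ f M ≠ i)
    (hfib : ∀ M₁ M₂ : Ideal R, M₁.IsMaximal → M₂.IsMaximal →
      f M₁ = f M₂ → M₁ = M₂) : IsCleanRing R := by
  classical
  have := Fintype.ofFinite ι
  intro r
  have one_nm : ∀ M : Ideal R, M.IsMaximal → (1 : R) ∉ M := fun M hM h =>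
    hM.ne_top ((Ideal.eq_top_iff_one _).2 h)
  let S₁ : Finset ι := Finset.univ.filter fun i =>
    ¬ (∀ M : Ideal R, M.IsMaximal → f M = i → r ∉ M)
  obtain ⟨e₁, he₁, hM₁⟩ := glue_idem f ε hε hM S₁
  refine ⟨r - e₁, e₁, ?_, he₁, by ring⟩
  refine isUnit_of_forall_maximal _ fun M hMm hmem => ?_
  by_cases h1 : f M ∈ S₁
  · have a := (hM₁ M hMm).1 h1
    have hh := (Finset.mem_filter.1 h1).2
    push Not at hh
    obtain ⟨M', hM', h', hr⟩ := hh
    obtain rfl := hfib _ _ hM' hMm h'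
    apply one_nm _ hM'
    have : (1 : R) = r - (r - e₁) + (1 - e₁) := by ring
    rw [this]
    exact add_mem (sub_mem hr hmem) a
  · have a := (hM₁ M hMm).2 h1
    have hh : (∀ M' : Ideal R, M'.IsMaximal → f M' = f M → r ∉ M') := by
      by_contra hc
      exact h1 (Finset.mem_filter.2 ⟨Finset.mem_univ _, hc⟩)
    apply hh M hMm rfl
    have : r = (r - e₁) + e₁ := by ring
    rw [this]
    exact add_mem hmem a

end Glue

section GroupAlg

variable {A G : Type*} [CommRing A] [CommGroup G]

/-- The subgroup of elements of `G` congruent to `1` modulo an ideal of `A[G]`. -/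
noncomputable def kerIdeal (M : Ideal (MonoidAlgebra A G)) : Subgroup G :=
  ((Ideal.Quotient.mk M).toMonoidHom.comp (MonoidAlgebra.of A G)).ker

lemma mem_kerIdeal (M : Ideal (MonoidAlgebra A G)) (g : G) :
    g ∈ kerIdeal M ↔ MonoidAlgebra.of A G g - 1 ∈ M := by
  rw [kerIdeal, MonoidHom.mem_ker, ← Ideal.Quotient.eq]
  simp

lemma subgroup_idem [Finite G] (hcard : IsUnit (Nat.card G : A)) (H : Subgroup G) :
    ∃ e : MonoidAlgebra A G, IsIdempotentElem e ∧ ∀ M : Ideal (MonoidAlgebra A G), M.IsMaximal →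
      (H ≤ kerIdeal M → 1 - e ∈ M) ∧ (¬ H ≤ kerIdeal M → e ∈ M) := by
  classical
  have := Fintype.ofFinite G
  have hH : IsUnit (Nat.card H : A) := by
    obtain ⟨t, ht⟩ := H.card_subgroup_dvd_card
    rw [ht, Nat.cast_mul] at hcard
    exact isUnit_of_mul_isUnit_left hcard
  obtain ⟨c, hc⟩ := hH.exists_left_inv
  set C := algebraMap A (MonoidAlgebra A G) c with hCdef
  have hC : C * (Nat.card H : MonoidAlgebra A G) = 1 := by
    rw [hCdef, ← map_natCast (algebraMap A (MonoidAlgebra A G)), ← map_mul, hc, map_one]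
  set s : MonoidAlgebra A G := ∑ h : H, MonoidAlgebra.of A G (h : G) with hs
  have hmul : ∀ h : H, MonoidAlgebra.of A G (h : G) * s = s := by
    intro h
    rw [hs, Finset.mul_sum]
    simp only [← map_mul]
    exact Fintype.sum_equiv (Equiv.mulLeft h) _ _ (fun x => by simp)
  have hss : s * s = (Nat.card H : MonoidAlgebra A G) * s := by
    conv_lhs => rw [hs, Finset.sum_mul]
    rw [Finset.sum_congr rfl fun h _ => hmul h]
    simp [Nat.card_eq_fintype_card]
  refine ⟨C * s, ?_, fun M hM => ⟨fun h => ?_, fun h => ?_⟩⟩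
  · unfold IsIdempotentElem
    calc C * s * (C * s) = C * C * (s * s) := by ring
      _ = (C * (Nat.card H : MonoidAlgebra A G)) * (C * s) := by rw [hss]; ring
      _ = C * s := by rw [hC, one_mul]
  · have : 1 - C * s = C * ∑ h : H, (1 - MonoidAlgebra.of A G (h : G)) := by
      rw [Finset.sum_sub_distrib, mul_sub, ← hs]
      simp only [Finset.sum_const, Finset.card_univ, nsmul_eq_mul, mul_one]
      rw [← Nat.card_eq_fintype_card, hC]
    rw [this]
    refine M.mul_mem_left _ (sum_mem fun x _ => ?_)
    rw [← neg_sub]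
    exact neg_mem ((mem_kerIdeal M _).1 (h x.2))
  · obtain ⟨x, hx, hx'⟩ := SetLike.not_le_iff_exists.1 h
    rw [mem_kerIdeal] at hx'
    refine M.mul_mem_left _ ?_
    have h0 : (MonoidAlgebra.of A G x - 1) * s = 0 := by
      rw [sub_mul, one_mul, hmul ⟨x, hx⟩, sub_self]
    exact (hM.isPrime.mem_or_mem (h0 ▸ M.zero_mem)).resolve_left hx'

lemma exists_ker_idem [Finite G] (hcard : IsUnit (Nat.card G : A)) :
    ∃ ε : Subgroup G → MonoidAlgebra A G, (∀ H, IsIdempotentElem (ε H)) ∧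
      ∀ M : Ideal (MonoidAlgebra A G), M.IsMaximal → ∀ H, ε H ∈ M ↔ kerIdeal M ≠ H := by
  classical
  have := Fintype.ofFinite (Subgroup G)
  choose e he hM using subgroup_idem (A := A) (G := G) hcard
  refine ⟨fun H => e H * ∏ H' ∈ Finset.univ.filter (fun H' => H < H'), (1 - e H'),
    fun H => (he H).mul (idem_prod e he _), fun M hMm H => ?_⟩
  have hp := hMm.isPrime
  have one_nm : (1 : MonoidAlgebra A G) ∉ M := fun h => hMm.ne_top ((Ideal.eq_top_iff_one _).2 h)
  have e_iff : ∀ H, e H ∈ M ↔ ¬ H ≤ kerIdeal M := fun H =>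
    ⟨fun h h' => one_nm (by simpa using add_mem h ((hM H M hMm).1 h')), (hM H M hMm).2⟩
  have e_iff' : ∀ H, 1 - e H ∈ M ↔ H ≤ kerIdeal M := fun H =>
    ⟨fun h => by
      by_contra h'
      exact one_nm (by simpa using add_mem h ((hM H M hMm).2 h')), (hM H M hMm).1⟩
  rw [hp.mul_mem_iff_mem_or_mem, hp.prod_mem_iff, e_iff]
  simp only [Finset.mem_filter, Finset.mem_univ, true_and, e_iff']
  constructor
  · rintro (h | ⟨H', h1, h2⟩) rfl
    · exact h le_rfl
    · exact absurd h2 (not_le_of_gt h1)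
  · intro h
    by_cases h' : H ≤ kerIdeal M
    · exact Or.inr ⟨_, lt_of_le_of_ne h' (Ne.symm h), le_rfl⟩
    · exact Or.inl h'

end GroupAlg

section Fiber

lemma exists_unit_pow {Ω G : Type*} [Field Ω] [CommGroup G] [Finite G] (χ χ' : G →* Ωˣ)
    (hker : χ.ker = χ'.ker) (n : ℕ) [NeZero n] (hn : Monoid.exponent G = n) :
    ∃ u : (ZMod n)ˣ, ∀ g, χ' g = χ g ^ (u : ZMod n).val := by
  classical
  have hk : ∀ g, χ g = 1 ↔ χ' g = 1 := fun g => by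
    rw [← MonoidHom.mem_ker, ← MonoidHom.mem_ker, hker]
  have hfin : Finite χ.range := Set.finite_range χ
  have hcyc : IsCyclic χ.range := isCyclic_subgroup_units χ.range
  obtain ⟨⟨_, γ, rfl⟩, hγ⟩ := IsCyclic.exists_generator (α := χ.range)
  have hγ' : ∀ g, ∃ k : ℤ, χ g = χ γ ^ k := by
    intro g
    obtain ⟨k, hk⟩ := hγ ⟨χ g, g, rfl⟩
    exact ⟨k, by simpa using (congrArg Subtype.val hk).symm⟩
  have hord : orderOf (χ γ) = orderOf (χ' γ) := by
    rw [orderOf_eq_orderOf_iff]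
    intro m
    rw [← map_pow, ← map_pow, hk]
  have hmn : orderOf (χ γ) ∣ n := by
    rw [orderOf_dvd_iff_pow_eq_one, ← map_pow, ← hn, Monoid.pow_exponent_eq_one, map_one]
  have hpos : 0 < orderOf (χ γ) := Nat.pos_of_dvd_of_pos hmn (NeZero.pos n)
  have : NeZero (orderOf (χ γ)) := ⟨hpos.ne'⟩
  have h1 := IsPrimitiveRoot.orderOf (χ γ)
  have h2 : IsPrimitiveRoot (χ' γ) (orderOf (χ γ)) := hord ▸ IsPrimitiveRoot.orderOf (χ' γ)
  obtain ⟨a, -, hcop, ha⟩ := (h1.isPrimitiveRoot_iff' ).1 h2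
  obtain ⟨u, hu⟩ := ZMod.unitsMap_surjective hmn (ZMod.unitOfCoprime a hcop)
  have hua : χ γ ^ (u : ZMod n).val = χ' γ := by
    rw [← ha, pow_eq_pow_iff_modEq, ← ZMod.natCast_eq_natCast_iff]
    have := congrArg Units.val hu
    rw [ZMod.unitsMap_val, ZMod.coe_unitOfCoprime] at this
    rw [← this, ZMod.natCast_val]
  refine ⟨u, fun g => ?_⟩
  obtain ⟨k, hk'⟩ := hγ' g
  have : χ' g = χ' γ ^ k := by
    rw [← map_zpow, ← mul_inv_eq_one, ← map_inv, ← map_mul, ← hk, map_mul, map_inv, map_zpow, hk',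
      mul_inv_cancel]
  rw [this, hk', ← hua, ← zpow_natCast, ← zpow_natCast, zpow_comm]

open IsLocalRing

lemma exists_algHom_ker {A R : Type*} [CommRing A] [IsLocalRing A] [CommRing R] [Algebra A R]
    [Algebra.IsIntegral A R] (M : Ideal R) (hM : M.IsMaximal) :
    ∃ φ : R →ₐ[A] AlgebraicClosure (ResidueField A), ∀ r, φ r = 0 ↔ r ∈ M := by
  have hmax : (M.comap (algebraMap A R)).IsMaximal :=
    Ideal.isMaximal_comap_of_isIntegral_of_isMaximal M
  have : M.LiesOver (maximalIdeal A) := ⟨(IsLocalRing.eq_maximalIdeal hmax).symm⟩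
  let : Field (R ⧸ M) := Ideal.Quotient.field M
  let : Algebra (ResidueField A) (R ⧸ M) :=
    inferInstanceAs (Algebra (A ⧸ maximalIdeal A) (R ⧸ M))
  have : IsScalarTower A (ResidueField A) (R ⧸ M) :=
    inferInstanceAs (IsScalarTower A (A ⧸ maximalIdeal A) (R ⧸ M))
  have : Algebra.IsIntegral A (R ⧸ M) := inferInstance
  have : Algebra.IsIntegral (ResidueField A) (R ⧸ M) := Algebra.IsIntegral.tower_top A
  let ψ : (R ⧸ M) →ₐ[ResidueField A] AlgebraicClosure (ResidueField A) := IsAlgClosed.lift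
  refine ⟨(ψ.restrictScalars A).comp (Ideal.Quotient.mkₐ A M), fun r => ?_⟩
  simp [Ideal.Quotient.eq_zero_iff_mem]

variable {A G : Type*} [CommRing A] [IsLocalRing A] [Finite (ResidueField A)]
  [CommGroup G] [Finite G]

instance : Algebra.IsIntegral A (MonoidAlgebra A G) := by
  have : Module.Finite A (MonoidAlgebra A G) := inferInstance
  infer_instance

lemma eq_of_frob_pow (M M' : Ideal (MonoidAlgebra A G))
    (φ φ' : MonoidAlgebra A G →ₐ[A] AlgebraicClosure (ResidueField A))
    (h : ∀ r, φ r = 0 ↔ r ∈ M) (h' : ∀ r, φ' r = 0 ↔ r ∈ M') (s : ℕ)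
    (hs : ∀ g, φ' (MonoidAlgebra.of A G g) =
      φ (MonoidAlgebra.of A G g) ^ (Nat.card (ResidueField A)) ^ s) : M = M' := by
  classical
  have := Fintype.ofFinite (ResidueField A)
  let F : AlgebraicClosure (ResidueField A) →ₐ[A] AlgebraicClosure (ResidueField A) :=
    (FiniteField.frobeniusAlgHom (ResidueField A)
      (AlgebraicClosure (ResidueField A)) ^ s).restrictScalars A
  have hF : ∀ x, F x = x ^ (Nat.card (ResidueField A)) ^ s := by
    intro x
    simp only [F, AlgHom.coe_restrictScalars', Nat.card_eq_fintype_card, AlgHom.coe_pow,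
      FiniteField.coe_frobeniusAlgHom, pow_iterate]
  have hφ : φ' = F.comp φ := by
    apply MonoidAlgebra.algHom_ext
    · intro g
      have := hs g
      rw [← hF] at this
      simpa using this
    · exact Subsingleton.elim _ _
  ext r
  rw [← h, ← h', hφ, AlgHom.comp_apply, map_eq_zero_iff F F.injective]

lemma exists_class (n : ℕ) [NeZero n] (hn : Monoid.exponent G = n) (qu : (ZMod n)ˣ)
    (hq : (qu : ZMod n) = (Nat.card (ResidueField A) : ℕ))
    (M₁ : Ideal (MonoidAlgebra A G)) (hM₁ : M₁.IsMaximal) :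
    ∃ c : Ideal (MonoidAlgebra A G) → (ZMod n)ˣ ⧸ Subgroup.zpowers qu,
      ∀ M M', M.IsMaximal → M'.IsMaximal → kerIdeal M₁ = kerIdeal M → kerIdeal M₁ = kerIdeal M' →
        c M = c M' → M = M' := by
  classical
  obtain ⟨φ₁, hφ₁⟩ := exists_algHom_ker (A := A) M₁ hM₁
  let ch (φ : MonoidAlgebra A G →ₐ[A] AlgebraicClosure (ResidueField A)) :
      G →* (AlgebraicClosure (ResidueField A))ˣ :=
    ((φ : MonoidAlgebra A G →* AlgebraicClosure (ResidueField A)).comp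
      (MonoidAlgebra.of A G)).toHomUnits
  have hch : ∀ φ g, (ch φ g : AlgebraicClosure (ResidueField A)) = φ (MonoidAlgebra.of A G g) :=
    fun φ g => rfl
  have hchk : ∀ φ (M : Ideal (MonoidAlgebra A G)), (∀ r, φ r = 0 ↔ r ∈ M) →
      (ch φ).ker = kerIdeal M := by
    intro φ M h
    ext g
    rw [mem_kerIdeal, ← h, MonoidHom.mem_ker, map_sub, map_one, sub_eq_zero, ← hch, Units.val_eq_one]
  have key : ∀ M : Ideal (MonoidAlgebra A G), ∃ u : (ZMod n)ˣ, M.IsMaximal →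
      kerIdeal M₁ = kerIdeal M → ∃ φ : MonoidAlgebra A G →ₐ[A] AlgebraicClosure (ResidueField A),
        (∀ r, φ r = 0 ↔ r ∈ M) ∧ ∀ g, ch φ g = ch φ₁ g ^ (u : ZMod n).val := by
    intro M
    by_cases hM : M.IsMaximal ∧ kerIdeal M₁ = kerIdeal M
    · obtain ⟨φ, hφ⟩ := exists_algHom_ker (A := A) M hM.1
      obtain ⟨u, hu⟩ := exists_unit_pow (ch φ₁) (ch φ)
        (by rw [hchk _ _ hφ, hchk _ _ hφ₁, hM.2]) n hn
      exact ⟨u, fun _ _ => ⟨φ, hφ, hu⟩⟩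
    · exact ⟨1, fun h1 h2 => absurd ⟨h1, h2⟩ hM⟩
  choose u hu using key
  refine ⟨fun M => (u M : (ZMod n)ˣ ⧸ Subgroup.zpowers qu), fun M M' hM hM' hk hk' hc => ?_⟩
  obtain ⟨φ, h1, h2⟩ := hu M hM hk
  obtain ⟨φ', h1', h2'⟩ := hu M' hM' hk'
  rw [QuotientGroup.eq, ← mem_powers_iff_mem_zpowers] at hc
  obtain ⟨s, hs⟩ := hc
  refine eq_of_frob_pow M M' φ φ' h1 h1' s fun g => ?_
  rw [← hch, ← hch, ← Units.val_pow_eq_pow_val, h2, h2', ← pow_mul]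
  congr 1
  have hgn : ch φ₁ g ^ n = 1 := by rw [← map_pow, ← hn, Monoid.pow_exponent_eq_one, map_one]
  rw [pow_eq_pow_iff_modEq]
  refine Nat.ModEq.of_dvd (orderOf_dvd_of_pow_eq_one hgn) ?_
  rw [← ZMod.natCast_eq_natCast_iff]
  push_cast
  rw [ZMod.natCast_val, ZMod.natCast_val, ZMod.cast_id, ZMod.cast_id, ← hq]
  have : u M' = u M * qu ^ s := by
    have hs' : qu ^ s = (u M)⁻¹ * u M' := hs
    rw [hs', mul_inv_cancel_left]
  rw [this]; simp

lemma groupAlg_feeblyClean (n : ℕ) [NeZero n] (hn : Monoid.exponent G = n) (qu : (ZMod n)ˣ)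
    (hq : (qu : ZMod n) = (Nat.card (ResidueField A) : ℕ))
    (hcard : IsUnit (Nat.card G : A)) (h2 : IsUnit (2 : A))
    (hidx : (Subgroup.zpowers qu).index ≤ 2) : IsFeeblyCleanRing (MonoidAlgebra A G) := by
  classical
  obtain ⟨ε, hε, hM⟩ := exists_ker_idem (A := A) (G := G) hcard
  have h2' : IsUnit (2 : MonoidAlgebra A G) := by
    have := h2.map (algebraMap A (MonoidAlgebra A G))
    rwa [map_ofNat] at this
  refine feeblyClean_glue kerIdeal ε h2' hε hM fun M₁ M₂ M₃ m1 m2 m3 e1 e2 => ?_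
  obtain ⟨c, hc⟩ := exists_class (A := A) n hn qu hq M₁ m1
  by_contra! hne
  have h12 : c M₁ ≠ c M₂ := fun h => hne.1 (hc _ _ m1 m2 rfl e1 h)
  have h13 : c M₁ ≠ c M₃ := fun h => hne.2.1 (hc _ _ m1 m3 rfl e2 h)
  have h23 : c M₂ ≠ c M₃ := fun h => hne.2.2 (hc _ _ m2 m3 e1 e2 h)
  have := Fintype.ofFinite ((ZMod n)ˣ ⧸ Subgroup.zpowers qu)
  rw [Subgroup.index, Nat.card_eq_fintype_card] at hidx
  have : 2 < Fintype.card ((ZMod n)ˣ ⧸ Subgroup.zpowers qu) :=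
    Fintype.two_lt_card_iff.2 ⟨_, _, _, h12, h13, h23⟩
  omega

lemma groupAlg_clean (n : ℕ) [NeZero n] (hn : Monoid.exponent G = n) (qu : (ZMod n)ˣ)
    (hq : (qu : ZMod n) = (Nat.card (ResidueField A) : ℕ))
    (hcard : IsUnit (Nat.card G : A))
    (hidx : (Subgroup.zpowers qu).index ≤ 1) : IsCleanRing (MonoidAlgebra A G) := by
  classical
  obtain ⟨ε, hε, hM⟩ := exists_ker_idem (A := A) (G := G) hcard
  refine clean_glue kerIdeal ε hε hM fun M₁ M₂ m1 m2 e1 => ?_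
  obtain ⟨c, hc⟩ := exists_class (A := A) n hn qu hq M₁ m1
  have := Fintype.ofFinite ((ZMod n)ˣ ⧸ Subgroup.zpowers qu)
  rw [Subgroup.index, Nat.card_eq_fintype_card] at hidx
  exact hc _ _ m1 m2 rfl e1 (Fintype.card_le_one_iff.1 hidx _ _)

end Fiber

section Cyclo

open IsLocalRing Polynomial

lemma exists_surj_of_primitive {A B G : Type*} [CommRing A] [CommRing B] [IsDomain B] [Algebra A B]
    [CommGroup G] [Finite G] (n : ℕ) [NeZero n] (hn : Monoid.exponent G = n) (x : B)
    (hx : IsPrimitiveRoot x n) (hgen : ∀ b : B, ∃ f : A[X], aeval x f = b) :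
    ∃ F : MonoidAlgebra A G →+* B, Function.Surjective F := by
  classical
  have hR : HasEnoughRootsOfUnity B (Monoid.exponent G) := by
    rw [hn]
    exact ⟨⟨x, hx⟩, inferInstance⟩
  obtain ⟨E⟩ := CommGroup.monoidHom_mulEquiv_of_hasEnoughRootsOfUnity G B
  obtain ⟨g, hg⟩ := Monoid.exists_orderOf_eq_exponent (G := G)
    (Monoid.ExponentExists.of_finite)
  have hχ : orderOf (E.symm g) = n := by rw [MulEquiv.orderOf_eq, hg, hn]
  set χ := E.symm g with hχdef
  have hfin : Finite χ.range := Set.finite_range χ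
  have hcyc : IsCyclic χ.range := isCyclic_subgroup_units χ.range
  obtain ⟨⟨_, γ, rfl⟩, hγ⟩ := IsCyclic.exists_generator (α := χ.range)
  have hγ' : ∀ g, ∃ k : ℤ, χ g = χ γ ^ k := by
    intro g
    obtain ⟨k, hk⟩ := hγ ⟨χ g, g, rfl⟩
    exact ⟨k, by simpa using (congrArg Subtype.val hk).symm⟩
  have hord : orderOf (χ γ) = n := by
    apply Nat.dvd_antisymm
    · rw [orderOf_dvd_iff_pow_eq_one, ← map_pow, ← hn, Monoid.pow_exponent_eq_one, map_one]
    · rw [← hχ, orderOf_dvd_iff_pow_eq_one]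
      ext h
      obtain ⟨k, hk⟩ := hγ' h
      rw [MonoidHom.pow_apply, hk, ← zpow_natCast, zpow_comm, zpow_natCast, pow_orderOf_eq_one,
        one_zpow, MonoidHom.one_apply]
  have hz : IsPrimitiveRoot (χ γ : B) n := by
    rw [IsPrimitiveRoot.coe_units_iff, ← hord]
    exact IsPrimitiveRoot.orderOf _
  obtain ⟨i, -, hi⟩ := hz.eq_pow_of_pow_eq_one hx.pow_eq_one
  let F : MonoidAlgebra A G →ₐ[A] B := MonoidAlgebra.lift A B G ((Units.coeHom B).comp χ)
  refine ⟨F.toRingHom, fun b => ?_⟩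
  obtain ⟨f, rfl⟩ := hgen b
  refine ⟨aeval (MonoidAlgebra.of A G (γ ^ i)) f, ?_⟩
  have : F (MonoidAlgebra.of A G (γ ^ i)) = x := by
    simp [F, hi]
  calc F (aeval (MonoidAlgebra.of A G (γ ^ i)) f) = aeval (F (MonoidAlgebra.of A G (γ ^ i))) f :=
        (aeval_algHom_apply _ _ _).symm
    _ = _ := by rw [this]

lemma exists_surj {A G : Type*} [CommRing A] [CommGroup G] [Finite G] (n : ℕ) [NeZero n]
    (hn : Monoid.exponent G = n) (hnA : IsUnit (n : A))
    [IsDomain (A[X] ⧸ Ideal.span {cyclotomic n A})] :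
    ∃ F : MonoidAlgebra A G →+* (A[X] ⧸ Ideal.span {cyclotomic n A}), Function.Surjective F := by
  have hae : ∀ f : A[X], aeval (Ideal.Quotient.mk (Ideal.span {cyclotomic n A}) X) f =
      Ideal.Quotient.mk (Ideal.span {cyclotomic n A}) f := by
    intro f
    have := aeval_algHom_apply (Ideal.Quotient.mkₐ A (Ideal.span {cyclotomic n A})) X f
    simpa using this
  refine exists_surj_of_primitive n hn (Ideal.Quotient.mk _ X) ?_ fun b => ?_
  · have : NeZero (n : A[X] ⧸ Ideal.span {cyclotomic n A}) := by
      have := hnA.map (algebraMap A (A[X] ⧸ Ideal.span {cyclotomic n A}))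
      rw [map_natCast] at this
      exact ⟨this.ne_zero⟩
    rw [← isRoot_cyclotomic_iff, IsRoot, ← map_cyclotomic n (algebraMap A (A[X] ⧸ Ideal.span {cyclotomic n A})),
      eval_map_algebraMap,
      hae, Ideal.Quotient.eq_zero_iff_mem]
    exact Ideal.subset_span rfl
  · obtain ⟨f, rfl⟩ := Ideal.Quotient.mk_surjective b
    exact ⟨f, hae f⟩

variable {A : Type*} [CommRing A] [IsLocalRing A]

lemma not_isUnit_of_dvd (n : ℕ) (P : (ResidueField A)[X]) (hP : Irreducible P)
    (hPn : P ∣ cyclotomic n (ResidueField A)) (r : A[X]) (hr : P ∣ r.map (residue A)) :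
    ¬ IsUnit (Ideal.Quotient.mk (Ideal.span {cyclotomic n A}) r) := by
  intro hu
  obtain ⟨b, hb⟩ := hu.exists_right_inv
  obtain ⟨s, rfl⟩ := Ideal.Quotient.mk_surjective b
  rw [← map_mul, ← map_one (Ideal.Quotient.mk _), Ideal.Quotient.eq, Ideal.mem_span_singleton] at hb
  have := map_dvd (mapRingHom (residue A)) hb
  simp only [coe_mapRingHom, map_cyclotomic, Polynomial.map_sub, Polynomial.map_mul,
    Polynomial.map_one] at this
  have h1 := hPn.trans this
  have h2 : P ∣ 1 := (dvd_sub_right (hr.mul_right _)).1 h1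
  exact hP.not_isUnit (isUnit_of_dvd_one h2)

variable [Fintype (ResidueField A)] {p f : ℕ} [Fact p.Prime]

lemma index_eq (n : ℕ) [NeZero n] (qu : (ZMod n)ˣ) :
    (Subgroup.zpowers qu).index = Nat.totient n / orderOf qu := by
  rw [← ZMod.card_units_eq_totient n, ← Nat.card_eq_fintype_card,
    ← (Subgroup.zpowers qu).card_mul_index, Nat.card_zpowers,
    Nat.mul_div_cancel_left _ (orderOf_pos qu)]

open UniqueFactorizationMonoid in
lemma exists_factors (n : ℕ) [NeZero n] (hk : Fintype.card (ResidueField A) = p ^ f)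
    (hpn : p.Coprime n) (m : ℕ)
    (hm : m ≤ (Subgroup.zpowers (ZMod.unitOfCoprime _ (hpn.pow_left f))).index) :
    ∃ P : Fin m → (ResidueField A)[X], (∀ i, Irreducible (P i)) ∧
      (∀ i, P i ∣ cyclotomic n (ResidueField A)) ∧
      Pairwise (Function.onFun IsCoprime fun i => Ideal.span {P i}) := by
  classical
  rw [index_eq, ← normalizedFactors_cyclotomic_card hk hpn] at hm
  obtain ⟨t, ht, htc⟩ := Finset.exists_subset_card_eq hm
  let e := t.equivFinOfCardEq htc
  have hmem : ∀ i, (e.symm i : (ResidueField A)[X]) ∈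
      normalizedFactors (cyclotomic n (ResidueField A)) := fun i =>
    Multiset.mem_toFinset.1 (ht (e.symm i).2)
  have hirr : ∀ i, Irreducible (e.symm i : (ResidueField A)[X]) := fun i =>
    irreducible_of_normalized_factor _ (hmem i)
  refine ⟨fun i => e.symm i, hirr, fun i => dvd_of_mem_normalizedFactors (hmem i), ?_⟩
  intro i j hij
  simp only [Function.onFun]
  rw [Ideal.isCoprime_span_singleton_iff, (hirr i).coprime_iff_not_dvd]
  intro hd
  apply hij
  have h1 := (hirr i).associated_of_dvd (hirr j) hd
  have h2 := h1.eq_of_normalized (normalize_normalized_factor _ (hmem i))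
    (normalize_normalized_factor _ (hmem j))
  exact e.symm.injective (Subtype.ext h2)

lemma exists_crt (n : ℕ) [NeZero n] (hk : Fintype.card (ResidueField A) = p ^ f)
    (hpn : p.Coprime n) (m : ℕ)
    (hm : m ≤ (Subgroup.zpowers (ZMod.unitOfCoprime _ (hpn.pow_left f))).index) (a : Fin m → A) :
    ∃ r : A[X] ⧸ Ideal.span {cyclotomic n A}, ∀ i, ¬ IsUnit (r - algebraMap A _ (a i)) := by
  obtain ⟨P, h1, h2, h3⟩ := exists_factors n hk hpn m hm
  obtain ⟨r, hr⟩ := Ideal.exists_forall_sub_mem_ideal h3 (fun i => C (residue A (a i)))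
  obtain ⟨s, rfl⟩ := Polynomial.map_surjective (residue A) residue_surjective r
  refine ⟨Ideal.Quotient.mk _ s, fun i => ?_⟩
  have := not_isUnit_of_dvd n (P i) (h1 i) (h2 i) (s - C (a i)) (by
    have := hr i
    rw [Ideal.mem_span_singleton] at this
    simpa using this)
  rw [map_sub] at this
  exact this

lemma index_le_two_of_feeblyClean (n : ℕ) [NeZero n]
    (hk : Fintype.card (ResidueField A) = p ^ f)
    (hpn : p.Coprime n) [IsDomain (A[X] ⧸ Ideal.span {cyclotomic n A})]
    (h : IsFeeblyCleanRing (A[X] ⧸ Ideal.span {cyclotomic n A})) :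
    (Subgroup.zpowers (ZMod.unitOfCoprime _ (hpn.pow_left f))).index ≤ 2 := by
  by_contra hlt
  obtain ⟨r, hr⟩ := exists_crt n hk hpn 3 (by omega) ![0, 1, -1]
  have r0 := hr 0
  have r1 := hr 1
  have r2 := hr 2
  simp at r0 r1 r2
  obtain ⟨u, e₁, e₂, hu, he₁, he₂, h0, rfl⟩ := h r
  rcases IsIdempotentElem.iff_eq_zero_or_one.1 he₁ with rfl | rfl <;>
  rcases IsIdempotentElem.iff_eq_zero_or_one.1 he₂ with rfl | rfl
  · exact r0 (by simpa using hu)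
  · exact r2 (by simpa using hu)
  · exact r1 (by simpa using hu)
  · simp at h0

lemma index_le_one_of_clean (n : ℕ) [NeZero n]
    (hk : Fintype.card (ResidueField A) = p ^ f)
    (hpn : p.Coprime n) [IsDomain (A[X] ⧸ Ideal.span {cyclotomic n A})]
    (h : IsCleanRing (A[X] ⧸ Ideal.span {cyclotomic n A})) :
    (Subgroup.zpowers (ZMod.unitOfCoprime _ (hpn.pow_left f))).index ≤ 1 := by
  by_contra hlt
  obtain ⟨r, hr⟩ := exists_crt n hk hpn 2 (by omega) ![0, 1]
  have r0 := hr 0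
  have r1 := hr 1
  simp at r0 r1
  obtain ⟨u, e₁, hu, he₁, rfl⟩ := h r
  rcases IsIdempotentElem.iff_eq_zero_or_one.1 he₁ with rfl | rfl
  · exact r0 (by simpa using hu)
  · exact r1 (by simpa using hu)

/-- The core equivalence. -/
lemma core {G : Type*} [CommGroup G] [Finite G] (n : ℕ) [NeZero n]
    (hn : Monoid.exponent G = n) (hk : Fintype.card (ResidueField A) = p ^ f)
    (hpn : p.Coprime n) [IsDomain (A[X] ⧸ Ideal.span {cyclotomic n A})]
    (hnA : IsUnit (n : A)) (hcard : IsUnit (Nat.card G : A)) (h2 : IsUnit (2 : A)) :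
    ((IsFeeblyCleanRing (MonoidAlgebra A G) ∧ ¬ IsCleanRing (MonoidAlgebra A G)) ↔
      (IsFeeblyCleanRing (A[X] ⧸ Ideal.span {cyclotomic n A}) ∧
        ¬ IsCleanRing (A[X] ⧸ Ideal.span {cyclotomic n A}))) ∧
    ((IsFeeblyCleanRing (MonoidAlgebra A G) ∧ ¬ IsCleanRing (MonoidAlgebra A G)) ↔
      Nat.totient n = 2 * orderOf ((p : ZMod n) ^ f)) := by
  set qu := ZMod.unitOfCoprime _ (hpn.pow_left f) with hqu
  have hq : (qu : ZMod n) = (Nat.card (ResidueField A) : ℕ) := by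
    rw [hqu, ZMod.coe_unitOfCoprime, Nat.card_eq_fintype_card, hk]
  obtain ⟨F, hF⟩ := exists_surj (A := A) (G := G) n hn hnA
  have a1 := groupAlg_feeblyClean (A := A) n hn qu hq hcard h2
  have a2 : IsFeeblyCleanRing (MonoidAlgebra A G) → _ := IsFeeblyCleanRing.of_surj F hF
  have a3 := index_le_two_of_feeblyClean (A := A) n hk hpn
  have b1 := groupAlg_clean (A := A) n hn qu hq hcard
  have b2 : IsCleanRing (MonoidAlgebra A G) → _ := IsCleanRing.of_surj F hF
  have b3 := index_le_one_of_clean (A := A) n hk hpn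
  rw [← hqu] at a3 b3
  have c1 : Nat.totient n = 2 * orderOf ((p : ZMod n) ^ f) ↔ (Subgroup.zpowers qu).index = 2 := by
    have : orderOf ((p : ZMod n) ^ f) = orderOf qu := by
      rw [← orderOf_units, hqu, ZMod.coe_unitOfCoprime, Nat.cast_pow]
    rw [this, ← ZMod.card_units_eq_totient n, ← Nat.card_eq_fintype_card,
      ← (Subgroup.zpowers qu).card_mul_index, Nat.card_zpowers, mul_comm 2]
    exact Nat.mul_right_inj (orderOf_pos qu).ne'
  have c2 : (Subgroup.zpowers qu).index ≠ 0 := Subgroup.index_ne_zero_of_finite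
  rw [c1]
  have c3 : (Subgroup.zpowers qu).index = 2 ↔ (Subgroup.zpowers qu).index ≤ 2 ∧
    ¬ (Subgroup.zpowers qu).index ≤ 1 := by omega
  rw [c3]
  tauto

end Cyclo

section SqrtCyclo

lemma int_dvd_of_dvd {F : Type*} [Field F] [NumberField F] {a b : ℤ}
    (h : (a : 𝓞 F) ∣ (b : 𝓞 F)) : a ∣ b := by
  have h1 := map_dvd (Algebra.norm ℤ) h
  have e : ∀ x : ℤ, Algebra.norm ℤ (x : 𝓞 F) = x ^ Module.finrank ℤ (𝓞 F) := fun x => by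
    rw [← Algebra.norm_algebraMap, eq_intCast]
  rw [e, e] at h1
  have hpos : Module.finrank ℤ (𝓞 F) ≠ 0 := by
    rw [RingOfIntegers.rank]
    exact Module.finrank_pos.ne'
  exact (Int.pow_dvd_pow_iff hpos).1 h1

lemma mem_of_sq_mem {R : Type*} [CommRing R] (z : R) (hz : Algebra.adjoin ℤ {z} = ⊤) (I : Ideal R)
    (l k : ℕ) (hl : l.Prime) (hk : 0 < k) (hlI : (l : R) ∈ I) (hzI : z ^ l ^ k - z ∈ I)
    (y : R) (hy : y ^ 2 ∈ I) : y ∈ I := by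
  by_cases hI : I = ⊤
  · rw [hI]; trivial
  have : Nontrivial (R ⧸ I) := Ideal.Quotient.nontrivial_iff.2 hI
  have : Fact l.Prime := ⟨hl⟩
  have hl0 : (l : R ⧸ I) = 0 := by
    rw [← map_natCast (Ideal.Quotient.mk I), Ideal.Quotient.eq_zero_iff_mem]; exact hlI
  have : CharP (R ⧸ I) l := by
    obtain ⟨c, hc⟩ := CharP.exists (R ⧸ I)
    rcases (Nat.dvd_prime hl).1 ((CharP.cast_eq_zero_iff (R ⧸ I) c l).1 hl0) with h | h
    · exact absurd h (CharP.char_ne_one (R ⧸ I) c)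
    · exact h ▸ hc
  have key : ∀ y : R, Ideal.Quotient.mk I y ^ l ^ k = Ideal.Quotient.mk I y := by
    intro y
    rw [← iterateFrobenius_def]
    have hyt : y ∈ Algebra.adjoin ℤ {z} := hz ▸ trivial
    induction hyt using Algebra.adjoin_induction with
    | mem x hx =>
      rw [Set.mem_singleton_iff.1 hx, iterateFrobenius_def, ← map_pow, Ideal.Quotient.eq]
      exact hzI
    | algebraMap r => simp
    | add x y _ _ hx hy => rw [map_add, map_add, hx, hy]
    | mul x y _ _ hx hy => rw [map_mul, map_mul, hx, hy]
  have h2 : 2 ≤ l ^ k := hl.two_le.trans (Nat.le_self_pow hk.ne' l)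
  rw [← Ideal.Quotient.eq_zero_iff_mem, ← key, ← map_pow, Ideal.Quotient.eq_zero_iff_mem]
  exact I.mem_of_dvd (pow_dvd_pow y h2) hy

variable {F : Type*} [Field F] [NumberField F] {n : ℕ} [NeZero n]
  [IsCyclotomicExtension {n} ℚ F] {ζ : 𝓞 F}

lemma dvd_of_sq_dvd (hζ : IsPrimitiveRoot ζ n) (hz : Algebra.adjoin ℤ {ζ} = ⊤) (l : ℕ)
    (hl : l.Prime) (hln : ¬ l ∣ n) (y : 𝓞 F) (hy : (l : 𝓞 F) ∣ y ^ 2) : (l : 𝓞 F) ∣ y := by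
  rw [← Ideal.mem_span_singleton] at hy ⊢
  refine mem_of_sq_mem ζ hz _ l (Nat.totient n) hl (Nat.totient_pos.2 (NeZero.pos n))
    (Ideal.mem_span_singleton_self _) ?_ y hy
  have h1 : l ^ Nat.totient n ≡ 1 [MOD n] :=
    Nat.ModEq.pow_totient (hl.coprime_iff_not_dvd.2 hln)
  have : ζ ^ l ^ Nat.totient n = ζ := by
    conv_rhs => rw [← pow_one ζ]
    rw [(hζ.isOfFinOrder (NeZero.ne n)).pow_eq_pow_iff_modEq, ← hζ.eq_orderOf]
    exact h1
  rw [this, sub_self]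
  exact zero_mem _

lemma dvd_of_sq_dvd_two (hζ : IsPrimitiveRoot ζ n) (hz : Algebra.adjoin ℤ {ζ} = ⊤)
    (hln : ¬ 4 ∣ n) (y : 𝓞 F) (hy : (2 : 𝓞 F) ∣ y ^ 2) : (2 : 𝓞 F) ∣ y := by
  obtain ⟨m, hm, hmn⟩ : ∃ m, ¬ 2 ∣ m ∧ n ∣ m * 2 := by
    by_cases h : 2 ∣ n
    · obtain ⟨m, rfl⟩ := h
      exact ⟨m, fun ⟨t, ht⟩ => hln ⟨t, by rw [ht]; ring⟩, by rw [mul_comm]⟩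
    · exact ⟨n, h, Dvd.intro _ rfl⟩
  have hm0 : 0 < m := Nat.pos_of_ne_zero fun h => hm (h ▸ dvd_zero _)
  rw [← Ideal.mem_span_singleton] at hy ⊢
  refine mem_of_sq_mem ζ hz _ 2 (Nat.totient m) Nat.prime_two (Nat.totient_pos.2 hm0)
    (Ideal.subset_span (by simp)) ?_ y hy
  have h1 : 1 ≡ 2 ^ Nat.totient m [MOD m] :=
    (Nat.ModEq.pow_totient (Nat.prime_two.coprime_iff_not_dvd.2 hm)).symm
  have h2 : m ∣ 2 ^ Nat.totient m - 1 := (Nat.modEq_iff_dvd' Nat.one_le_two_pow).1 h1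
  have h3 : (ζ ^ (2 ^ Nat.totient m - 1)) ^ 2 = 1 := by
    rw [← pow_mul, hζ.pow_eq_one_iff_dvd]
    exact hmn.trans (Nat.mul_dvd_mul_right h2 2)
  have h4 : ζ ^ 2 ^ Nat.totient m = ζ * ζ ^ (2 ^ Nat.totient m - 1) := by
    rw [← pow_succ', Nat.sub_add_cancel Nat.one_le_two_pow]
  rw [h4, Ideal.mem_span_singleton]
  set w := ζ ^ (2 ^ Nat.totient m - 1)
  have h5 : (w - 1) * (w + 1) = 0 := by linear_combination h3
  rcases mul_eq_zero.1 h5 with h | h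
  · exact ⟨0, by linear_combination ζ * h⟩
  · exact ⟨-ζ, by linear_combination ζ * h⟩

lemma prime_dvd_n (hζ : IsPrimitiveRoot ζ n) (hz : Algebra.adjoin ℤ {ζ} = ⊤) (d : ℤ)
    (hd : Squarefree d) (y : 𝓞 F) (hy : y ^ 2 = (d : 𝓞 F)) (l : ℕ) (hl : l.Prime)
    (hld : (l : ℤ) ∣ d) : l ∣ n := by
  by_contra hln
  have h1 : (l : 𝓞 F) ∣ y := dvd_of_sq_dvd hζ hz l hl hln y (by
    rw [hy]; obtain ⟨e, rfl⟩ := hld; exact ⟨e, by push_cast; rfl⟩)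
  have h2 := pow_dvd_pow_of_dvd h1 2
  rw [hy] at h2
  have h3 : ((l : ℤ) ^ 2) ∣ d := int_dvd_of_dvd (F := F) (by push_cast; exact h2)
  have := hd (l : ℤ) (by rwa [← sq])
  exact hl.one_lt.ne' (by simpa [Int.isUnit_iff_natAbs_eq] using this)

lemma four_dvd_n (hζ : IsPrimitiveRoot ζ n) (hz : Algebra.adjoin ℤ {ζ} = ⊤) (d : ℤ)
    (hd : d % 4 = 3) (y : 𝓞 F) (hy : y ^ 2 = (d : 𝓞 F)) : 4 ∣ n := by
  by_contra hln
  have h1 : (2 : 𝓞 F) ∣ y + 1 := dvd_of_sq_dvd_two hζ hz hln _ (by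
    obtain ⟨e, he⟩ : ∃ e, d = 2 * e + 1 := ⟨d / 2, by omega⟩
    refine ⟨e + 1 + y, ?_⟩
    have : (y + 1) ^ 2 = y ^ 2 + 1 + 2 * y := by ring
    rw [this, hy, he]; push_cast; ring)
  obtain ⟨w, hw⟩ := h1
  have hy' : y = 2 * w - 1 := by rw [← hw]; ring
  have h3 : (4 : ℤ) ∣ d - 1 := int_dvd_of_dvd (F := F) (by
    push_cast
    rw [← hy, hy']
    exact ⟨w ^ 2 - w, by ring⟩)
  omega

lemma eight_dvd_n (hζ : IsPrimitiveRoot ζ n) (hz : Algebra.adjoin ℤ {ζ} = ⊤) (d : ℤ)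
    (hd : d % 4 = 2) (y : 𝓞 F) (hy : y ^ 2 = (d : 𝓞 F)) : 8 ∣ n := by
  by_contra hln
  obtain ⟨c, hc⟩ : ∃ c, d = 2 * (2 * c + 1) := ⟨d / 4, by omega⟩
  have hy2 : y ^ 2 = 2 * (2 * (c : 𝓞 F) + 1) := by rw [hy, hc]; push_cast; ring
  by_cases h4 : 4 ∣ n
  swap
  · have h1 := dvd_of_sq_dvd_two hζ hz h4 y ⟨_, hy2⟩
    have h2 := pow_dvd_pow_of_dvd h1 2
    rw [hy] at h2
    have h3 : (4 : ℤ) ∣ d := int_dvd_of_dvd (F := F) (by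
      push_cast; rw [show (4 : 𝓞 F) = 2 ^ 2 by norm_num]; exact h2)
    omega
  obtain ⟨m, hm⟩ := h4
  have hm2 : ¬ 2 ∣ m := fun ⟨t, ht⟩ => hln ⟨t, by rw [hm, ht]; ring⟩
  have hm0 : 0 < m := Nat.pos_of_ne_zero fun h => hm2 (h ▸ dvd_zero _)
  obtain ⟨i, hi⟩ : ∃ i : 𝓞 F, i ^ 2 = -1 := by
    have := hζ.pow (NeZero.pos n) (a := m * 2) (b := 2) (by rw [hm]; ring)
    exact ⟨ζ ^ m, by rw [← pow_mul]; exact this.eq_neg_one_of_two_right⟩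
  have h2I : (2 : 𝓞 F) ∈ Ideal.span {1 + i} := by
    rw [Ideal.mem_span_singleton]
    exact ⟨1 - i, by linear_combination hi⟩
  have frob : ∀ y : 𝓞 F, (1 + i) ∣ y ^ 2 → (1 + i) ∣ y := by
    intro y hy
    rw [← Ideal.mem_span_singleton] at hy ⊢
    refine mem_of_sq_mem ζ hz _ 2 (Nat.totient m) Nat.prime_two (Nat.totient_pos.2 hm0)
      (by exact_mod_cast h2I) ?_ y hy
    have h1 : 1 ≡ 2 ^ Nat.totient m [MOD m] :=
      (Nat.ModEq.pow_totient (Nat.prime_two.coprime_iff_not_dvd.2 hm2)).symm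
    have h2 : m ∣ 2 ^ Nat.totient m - 1 := (Nat.modEq_iff_dvd' Nat.one_le_two_pow).1 h1
    have h3 : (ζ ^ (2 ^ Nat.totient m - 1)) ^ 4 = 1 := by
      rw [← pow_mul, hζ.pow_eq_one_iff_dvd, hm, mul_comm]
      exact (Nat.mul_dvd_mul_right h2 4)
    have h4 : ζ ^ 2 ^ Nat.totient m = ζ * ζ ^ (2 ^ Nat.totient m - 1) := by
      rw [← pow_succ', Nat.sub_add_cancel Nat.one_le_two_pow]
    rw [h4]
    set w := ζ ^ (2 ^ Nat.totient m - 1)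
    have h5 : ζ * w - ζ = ζ * (w - 1) := by ring
    rw [h5]
    refine Ideal.mul_mem_left _ _ ?_
    have h6 : (w - 1) * ((w + 1) * ((w - i) * (w + i))) = 0 := by
      linear_combination h3 - (w ^ 2 - 1) * hi
    rw [Ideal.mem_span_singleton] at h2I ⊢
    obtain ⟨t, ht⟩ := h2I
    rcases mul_eq_zero.1 h6 with h | h
    · rw [h]; exact dvd_zero _
    rcases mul_eq_zero.1 h with h | h
    · exact ⟨-t, by linear_combination h - ht⟩
    rcases mul_eq_zero.1 h with h | h
    · exact ⟨1 - t, by linear_combination h - ht⟩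
    · exact ⟨-1, by linear_combination h⟩
  have h2I' := Ideal.mem_span_singleton.1 h2I
  obtain ⟨z, hzy⟩ := frob y (h2I'.trans ⟨_, hy2⟩)
  have hz2 : z ^ 2 = - i * (2 * c + 1) := by
    have : (2 : 𝓞 F) * (z ^ 2 - (- i * (2 * c + 1))) = 0 := by
      rw [hzy] at hy2
      linear_combination -i * hy2 + (i * z ^ 2 + 2 * z ^ 2) * hi
    rcases mul_eq_zero.1 this with h | h
    · exact absurd h two_ne_zero
    · exact sub_eq_zero.1 h
  obtain ⟨v, hv⟩ := frob (z - 1) (by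
    have : (z - 1) ^ 2 = (1 + i) * (-1) + 2 * (1 - i * c - z) := by linear_combination hz2
    rw [this]
    exact dvd_add (Dvd.intro _ rfl) (h2I'.mul_right _))
  have hz1 : z = 1 + (1 + i) * v := by linear_combination hv
  have hpi : (1 + i) = 2 * (-(i * c) - (1 + i) * v - i * v ^ 2) := by
    rw [hz1] at hz2
    linear_combination hz2 - v ^ 2 * hi
  generalize (-(i * c) - (1 + i) * v - i * v ^ 2) = t at hpi
  have h7 : (2 : 𝓞 F) * (2 * t ^ 2 - i) = 0 := by
    linear_combination (-(1 + i) - 2 * t) * hpi + hi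
  have h8 : 2 * t ^ 2 = i := by
    rcases mul_eq_zero.1 h7 with h | h
    · exact absurd h two_ne_zero
    · exact sub_eq_zero.1 h
  have h9 : ((2 : ℤ) : 𝓞 F) ∣ ((1 : ℤ) : 𝓞 F) := ⟨-(t ^ 2 * i), by
    push_cast; linear_combination i * h8 + hi⟩
  have := int_dvd_of_dvd h9
  omega

lemma disc_dvd_n (hζ : IsPrimitiveRoot ζ n) (hz : Algebra.adjoin ℤ {ζ} = ⊤) (d : ℤ)
    (hd : Squarefree d) (Δ : ℤ) (hΔ : (d % 4 = 1 ∧ Δ = d) ∨ (d % 4 ≠ 1 ∧ Δ = 4 * d))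
    (y : 𝓞 F) (hy : y ^ 2 = (d : 𝓞 F)) : Δ ∣ (n : ℤ) := by
  have hp := prime_dvd_n hζ hz d hd y hy
  have hd0 : d ≠ 0 := hd.ne_zero
  have hdn : d ∣ n := by
    rw [← Int.natAbs_dvd_natAbs, Int.natAbs_natCast,
      ← Nat.prod_primeFactors_of_squarefree (Int.squarefree_natAbs.2 hd)]
    refine Finset.prod_primes_dvd _ (fun a ha => (Nat.prime_of_mem_primeFactors ha).prime)
      fun a ha => ?_
    exact hp a (Nat.prime_of_mem_primeFactors ha)
      (Int.natCast_dvd.2 (Nat.dvd_of_mem_primeFactors ha))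
  rcases hΔ with ⟨-, rfl⟩ | ⟨h, rfl⟩
  · exact hdn
  · have h0 : d % 4 ≠ 0 := fun h0 => by
      have := hd 2 (by omega)
      simp [Int.isUnit_iff] at this
    have : d % 4 = 2 ∨ d % 4 = 3 := by omega
    rcases this with h2 | h3
    · have h8 := eight_dvd_n hζ hz d h2 y hy
      obtain ⟨e, rfl⟩ : (2 : ℤ) ∣ d := by omega
      have h8' : (8 : ℤ) ∣ n := by exact_mod_cast h8
      have hc : IsCoprime (8 : ℤ) e := by
        have : IsCoprime ((2 : ℤ) ^ 3) e := IsCoprime.pow_left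
          ((Int.prime_two.coprime_iff_not_dvd).2 (by omega))
        simpa using this
      have := hc.mul_dvd h8' ((Dvd.intro_left 2 rfl).trans hdn)
      rwa [show (4 : ℤ) * (2 * e) = 8 * e by ring]
    · have h4 := four_dvd_n hζ hz d h3 y hy
      have h4' : (4 : ℤ) ∣ n := by exact_mod_cast h4
      have hc : IsCoprime (4 : ℤ) d := by
        have : IsCoprime ((2 : ℤ) ^ 2) d := IsCoprime.pow_left
          ((Int.prime_two.coprime_iff_not_dvd).2 (by omega))
        simpa using this
      exact hc.mul_dvd h4' hdn

end SqrtCyclo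

section Irr

open Polynomial in
lemma cyclotomic_irreducible_K {K : Type*} [Field K] [NumberField K] (d : ℤ) (hd : Squarefree d)
    (α : K) (hα : α ^ 2 = (d : K)) (hrank : Module.finrank ℚ K = 2)
    (Δ : ℤ) (hΔ : (d % 4 = 1 ∧ Δ = d) ∨ (d % 4 ≠ 1 ∧ Δ = 4 * d))
    (n : ℕ) [NeZero n] (hΔn : ¬ Δ ∣ (n : ℤ)) : Irreducible (cyclotomic n K) := by
  let L := CyclotomicField n K
  have hζ : IsPrimitiveRoot (IsCyclotomicExtension.zeta n K L) n :=
    IsCyclotomicExtension.zeta_spec n K L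
  set ζ := IsCyclotomicExtension.zeta n K L with hζdef
  have hNF : NumberField L := IsCyclotomicExtension.numberField {n} K L
  have hcyc : IsCyclotomicExtension {n} ℚ (IntermediateField.adjoin ℚ {ζ}) :=
    hζ.intermediateField_adjoin_isCyclotomicExtension ℚ
  set F := IntermediateField.adjoin ℚ {ζ} with hF
  have hNFF : NumberField F := NumberField.of_intermediateField _
  have hgen : IsPrimitiveRoot (IntermediateField.AdjoinSimple.gen ℚ ζ) n :=
    IsPrimitiveRoot.coe_submonoidClass_iff.mp hζ
  have hα' : algebraMap K L α ∉ F := by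
    intro hmem
    have hsq : (⟨algebraMap K L α, hmem⟩ : F) ^ 2 = (d : F) := by
      apply Subtype.ext
      push_cast
      rw [← map_pow, hα, map_intCast]
    have hint : IsIntegral ℤ (⟨algebraMap K L α, hmem⟩ : F) := by
      refine IsIntegral.of_pow (n := 2) (by norm_num) ?_
      rw [hsq]
      exact isIntegral_algebraMap (R := ℤ) (x := d)
    refine hΔn (disc_dvd_n hgen.toInteger_isPrimitiveRoot
      (IsCyclotomicExtension.Rat.adjoin_singleton_eq_top hgen) d hd Δ hΔ
      ⟨⟨algebraMap K L α, hmem⟩, hint⟩ ?_)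
    apply RingOfIntegers.ext
    exact hsq
  have hFtop : F ≠ ⊤ := fun h => hα' (h ▸ IntermediateField.mem_top)
  have h1 : Module.finrank F L ≠ 1 := fun h => hFtop (IntermediateField.finrank_eq_one_iff_eq_top.1 h)
  have h2 : 0 < Module.finrank F L := Module.finrank_pos
  have h3 : Module.finrank ℚ F = n.totient := IsCyclotomicExtension.Rat.finrank n F
  have h4 : Module.finrank ℚ F * Module.finrank F L = Module.finrank ℚ L :=
    Module.finrank_mul_finrank ℚ F L
  have h5 : Module.finrank ℚ K * Module.finrank K L = Module.finrank ℚ L :=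
    Module.finrank_mul_finrank ℚ K L
  rw [hrank] at h5
  rw [h3] at h4
  have h6 : n.totient ≤ Module.finrank K L := by nlinarith [show 2 ≤ Module.finrank F L by omega]
  have h7 : (minpoly K ζ).natDegree = Module.finrank K L := by
    rw [(hζ.powerBasis K).finrank, ← PowerBasis.natDegree_minpoly, IsPrimitiveRoot.powerBasis_gen]
  have hint : IsIntegral K ζ := hζ.isIntegral (NeZero.pos n) |>.tower_top
  have h8 : minpoly K ζ ∣ cyclotomic n K := by
    apply minpoly.dvd
    rw [aeval_def, eval₂_eq_eval_map, map_cyclotomic]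
    exact (isRoot_cyclotomic_iff.2 hζ)
  have h9 : cyclotomic n K = minpoly K ζ := by
    refine (eq_of_monic_of_dvd_of_natDegree_le (minpoly.monic hint) (cyclotomic.monic n K) h8 ?_)
    rw [natDegree_cyclotomic, h7]; exact h6
  rw [h9]
  exact minpoly.irreducible hint

open Polynomial in
lemma isDomain_quot {K : Type*} [Field K] [NumberField K] (𝔭 : Ideal (𝓞 K)) [𝔭.IsPrime]
    (h𝔭 : 𝔭 ≠ ⊥) (n : ℕ) (h : Irreducible (cyclotomic n K)) :
    IsDomain ((Localization.AtPrime 𝔭)[X] ⧸ Ideal.span {cyclotomic n (Localization.AtPrime 𝔭)}) := by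
  have hdvr : IsDiscreteValuationRing (Localization.AtPrime 𝔭) :=
    IsLocalization.AtPrime.isDiscreteValuationRing_of_dedekind_domain (𝓞 K) h𝔭 _
  have hu : ∀ y : 𝔭.primeCompl, IsUnit (algebraMap (𝓞 K) K y) := fun y => by
    rw [isUnit_iff_ne_zero]
    intro h0
    refine y.2 ?_
    rw [(FaithfulSMul.algebraMap_eq_zero_iff (𝓞 K) K).1 h0]
    exact 𝔭.zero_mem
  let _ : Algebra (Localization.AtPrime 𝔭) K := (IsLocalization.lift hu).toAlgebra
  have : IsScalarTower (𝓞 K) (Localization.AtPrime 𝔭) K :=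
    IsScalarTower.of_algebraMap_eq fun x => (IsLocalization.lift_eq hu x).symm
  have : IsFractionRing (Localization.AtPrime 𝔭) K :=
    IsFractionRing.isFractionRing_of_isDomain_of_isLocalization 𝔭.primeCompl
      (Localization.AtPrime 𝔭) K
  have h2 : Irreducible (cyclotomic n (Localization.AtPrime 𝔭)) := by
    rw [(cyclotomic.monic n _).irreducible_iff_irreducible_map_fraction_map
      (K := K), map_cyclotomic]
    exact h
  have h3 := h2.prime
  rw [← Ideal.span_singleton_prime h3.ne_zero] at h3
  exact Ideal.Quotient.isDomain _

end Irr

section Resid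

variable {K : Type*} [Field K] [NumberField K]

lemma absNorm_cases (hrank : Module.finrank ℚ K = 2) (p : ℕ) [Fact p.Prime]
    (𝔭 : Ideal (𝓞 K)) [𝔭.IsPrime] (hp : (p : 𝓞 K) ∈ 𝔭) :
    Ideal.absNorm 𝔭 = p ∨ Ideal.absNorm 𝔭 = p ^ 2 := by
  have h1 : Ideal.absNorm 𝔭 ∣ p ^ 2 := by
    rw [← hrank, ← RingOfIntegers.rank K, ← Ideal.absNorm_span_natCast]
    exact Ideal.absNorm_dvd_absNorm_of_le ((Ideal.span_singleton_le_iff_mem _).2 hp)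
  obtain ⟨k, hk, h⟩ := (Nat.dvd_prime_pow (Fact.out : p.Prime)).1 h1
  have h2 : Ideal.absNorm 𝔭 ≠ 1 := fun h => Ideal.IsPrime.ne_top' (Ideal.absNorm_eq_one_iff.1 h)
  interval_cases k
  · simp at h; exact absurd (Ideal.absNorm_eq_one_iff.2 h) h2
  · left; simpa using h
  · right; exact h

lemma isSquare_of_absNorm (d : ℤ) (a : 𝓞 K) (ha : a ^ 2 = (d : 𝓞 K)) (p : ℕ) [Fact p.Prime]
    (𝔭 : Ideal (𝓞 K)) [𝔭.IsPrime] (hp : (p : 𝓞 K) ∈ 𝔭) (h : Ideal.absNorm 𝔭 = p) :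
    IsSquare (d : ZMod p) := by
  have hp' : p.Prime := Fact.out
  have hl0 : (p : 𝓞 K ⧸ 𝔭) = 0 := by
    rw [← map_natCast (Ideal.Quotient.mk 𝔭), Ideal.Quotient.eq_zero_iff_mem]; exact hp
  have : CharP (𝓞 K ⧸ 𝔭) p := by
    obtain ⟨c, hc⟩ := CharP.exists (𝓞 K ⧸ 𝔭)
    rcases (Nat.dvd_prime hp').1 ((CharP.cast_eq_zero_iff (𝓞 K ⧸ 𝔭) c p).1 hl0) with h | h
    · exact absurd h (CharP.char_ne_one (𝓞 K ⧸ 𝔭) c)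
    · exact h ▸ hc
  let f := ZMod.castHom (dvd_refl p) (𝓞 K ⧸ 𝔭)
  have hinj : Function.Injective f := f.injective
  have hc : Nat.card (𝓞 K ⧸ 𝔭) = p := h
  have : Finite (𝓞 K ⧸ 𝔭) := Nat.finite_of_card_ne_zero (by rw [hc]; exact hp'.ne_zero)
  have hbij := (Nat.bijective_iff_injective_and_card f).2 ⟨hinj, by rw [hc, Nat.card_zmod]⟩
  obtain ⟨b, hb⟩ := hbij.2 (Ideal.Quotient.mk 𝔭 a)
  refine ⟨b, hinj ?_⟩
  rw [map_mul, hb, ← map_mul, ← sq, ha, map_intCast, map_intCast]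

lemma not_sq_int (d : ℤ) (hd : Squarefree d) (hd1 : d ≠ 1) (r : ℚ) : r ^ 2 ≠ d := by
  intro h
  have hs : IsSquare ((d : ℤ) : ℚ) := ⟨r, by rw [← h, sq]⟩
  rw [Rat.isSquare_intCast_iff] at hs
  obtain ⟨s, hs⟩ := hs
  have := hd s (by rw [hs])
  rcases Int.isUnit_iff.1 this with h | h <;> simp [h] at hs <;> exact hd1 hs

open Polynomial in
lemma absNorm_ne_sq (hrank : Module.finrank ℚ K = 2) (d : ℤ) (hd : Squarefree d) (hd1 : d ≠ 1)
    (a : 𝓞 K) (ha : a ^ 2 = (d : 𝓞 K)) (p : ℕ) [Fact p.Prime] (hp2 : p ≠ 2)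
    (𝔭 : Ideal (𝓞 K)) [𝔭.IsPrime] (hp : (p : 𝓞 K) ∈ 𝔭) (hsq : IsSquare (d : ZMod p)) :
    Ideal.absNorm 𝔭 ≠ p ^ 2 := by
  intro hN
  have hp' : p.Prime := Fact.out
  have hpe : 𝔭 = Ideal.span {(p : 𝓞 K)} := by
    have hle : 𝔭 ∣ Ideal.span {(p : 𝓞 K)} :=
      Ideal.dvd_iff_le.2 ((Ideal.span_singleton_le_iff_mem _).2 hp)
    obtain ⟨J, hJ⟩ := hle
    have h1 := congrArg Ideal.absNorm hJ
    rw [map_mul, Ideal.absNorm_span_natCast, RingOfIntegers.rank, hrank, hN] at h1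
    have h2 : Ideal.absNorm J = 1 := by
      have : 0 < p ^ 2 := pow_pos hp'.pos 2
      exact Nat.eq_of_mul_eq_mul_left this (by rw [← h1, mul_one])
    rw [Ideal.absNorm_eq_one_iff] at h2
    rw [hJ, h2, Ideal.mul_top]
  obtain ⟨b, hb⟩ := hsq
  obtain ⟨c₀, rfl⟩ := ZMod.intCast_surjective b
  have hdvd : (p : ℤ) ∣ d - c₀ * c₀ := by
    rw [← ZMod.intCast_zmod_eq_zero_iff_dvd]
    push_cast
    rw [hb, sub_self]
  have hmem : (a - c₀) * (a + c₀) ∈ 𝔭 := by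
    obtain ⟨e, he⟩ := hdvd
    have : (a - c₀) * (a + c₀) = (p : 𝓞 K) * e := by
      have h1 : (a - c₀) * (a + c₀) = a ^ 2 - c₀ * c₀ := by ring
      rw [h1, ha]
      exact_mod_cast congrArg (Int.cast : ℤ → 𝓞 K) he
    rw [this]
    exact 𝔭.mul_mem_right _ hp
  obtain ⟨c, hc, hcm⟩ : ∃ c : ℤ, (c = c₀ ∨ c = -c₀) ∧ a - c ∈ 𝔭 := by
    rcases Ideal.IsPrime.mem_or_mem inferInstance hmem with h | h
    · exact ⟨c₀, Or.inl rfl, h⟩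
    · exact ⟨-c₀, Or.inr rfl, by push_cast; rwa [sub_neg_eq_add]⟩
  rw [hpe, Ideal.mem_span_singleton] at hcm
  obtain ⟨β, hβ⟩ := hcm
  have hpQ : (p : ℚ) ≠ 0 := by exact_mod_cast hp'.ne_zero
  have hpK : (p : K) ≠ 0 := by exact_mod_cast hp'.ne_zero
  let Q : ℚ[X] := X ^ 2 + C (2 * c / p : ℚ) * X + C ((c ^ 2 - d) / p ^ 2 : ℚ)
  have hQdeg : Q.natDegree = 2 := by
    simp only [Q]; compute_degree!
  have hQm : Q.Monic := by
    simp only [Q]; monicity!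
  have hQirr : Irreducible Q := by
    rw [hQm.irreducible_iff_roots_eq_zero_of_degree_le_three hQdeg.ge (by omega)]
    rw [Multiset.eq_zero_iff_forall_notMem]
    intro r hr
    have h0 := (mem_roots'.1 hr).2
    simp only [Q, IsRoot, eval_add, eval_pow, eval_X, eval_mul, eval_C] at h0
    field_simp at h0
    refine not_sq_int d hd hd1 (p * r + c) ?_
    linear_combination h0
  have hβK : (algebraMap (𝓞 K) K a) = c + p * algebraMap (𝓞 K) K β := by
    have := congrArg (algebraMap (𝓞 K) K) hβ
    simp only [map_sub, map_mul, map_intCast, map_natCast] at this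
    linear_combination this
  have haK : (algebraMap (𝓞 K) K a) ^ 2 = d := by
    rw [← map_pow, ha, map_intCast]
  have hroot : aeval (algebraMap (𝓞 K) K β) Q = 0 := by
    simp only [Q, map_add, map_mul, map_pow, aeval_X, aeval_C]
    simp only [map_div₀, map_mul, map_sub, map_pow, map_intCast, map_natCast, map_ofNat]
    field_simp
    rw [hβK] at haK
    linear_combination haK
  have hmin := minpoly.eq_of_irreducible_of_monic hQirr hroot hQm
  have hint : IsIntegral ℤ (algebraMap (𝓞 K) K β) := RingOfIntegers.isIntegral_coe β
  rw [minpoly.isIntegrallyClosed_eq_field_fractions' ℚ hint] at hmin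
  have hc1 := congrArg (fun P => coeff P 1) hmin
  have hc0 := congrArg (fun P => coeff P 0) hmin
  simp [Q, coeff_X, coeff_C] at hc1 hc0
  set u := coeff (minpoly ℤ (algebraMap (𝓞 K) K β)) 1
  set v := coeff (minpoly ℤ (algebraMap (𝓞 K) K β)) 0
  have hpZ : Prime (p : ℤ) := Nat.prime_iff_prime_int.1 hp'
  have e1 : 2 * c = p * (u : ℤ) := by
    field_simp at hc1
    exact_mod_cast hc1
  have e0 : c ^ 2 - d = p ^ 2 * (v : ℤ) := by
    field_simp at hc0
    exact_mod_cast hc0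
  have hpc : (p : ℤ) ∣ c := by
    rcases hpZ.dvd_or_dvd (Dvd.intro _ e1.symm) with h | h
    · exfalso
      have h' : p ∣ 2 := by exact_mod_cast h
      exact hp2 ((Nat.prime_dvd_prime_iff_eq hp' Nat.prime_two).1 h')
    · exact h
  obtain ⟨w, rfl⟩ := hpc
  have := hd (p : ℤ) ⟨w ^ 2 - v, by linear_combination -e0⟩
  exact hpZ.not_isUnit this

lemma card_residue (𝔭 : Ideal (𝓞 K)) [𝔭.IsPrime] (h : 𝔭 ≠ ⊥) :
    Nat.card (IsLocalRing.ResidueField (Localization.AtPrime 𝔭)) = Ideal.absNorm 𝔭 := by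
  have : 𝔭.IsMaximal := Ideal.IsPrime.isMaximal inferInstance h
  exact (Nat.card_congr (Equiv.ofBijective _ 𝔭.bijective_algebraMap_quotient_residueField)).symm

end Resid

/-- Let `d ≠ 0, 1` be a squarefree integer, `K = ℚ(√d)` with ring of integers `𝒪` and
discriminant `Δ`, let `𝔭` be a nonzero prime ideal of `𝒪` lying over an odd prime `p`,
and let `G` be a nontrivial finite abelian group with `p ∤ exp(G)` and `Δ ∤ exp(G)`.
Then the following are equivalent: (i) `𝒪_𝔭[G]` is feebly clean but not clean;
(ii) `𝒪_𝔭[x]/(Φ_{exp G}(x))` is feebly clean but not clean; (iii) one of: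
(a) `φ(exp G) = 2·ord_{exp G}(p)` and `(Δ/p) ∈ {0, 1}`;
(b) `ord_{exp G}(p) = φ(exp G)/2` is odd and `(Δ/p) = -1`;
(c) `exp G ≠ 2`, `φ(exp G) = ord_{exp G}(p)`, and `(Δ/p) = -1`. -/
theorem feeblyClean_not_clean_quadratic_localization_monoidAlgebra_iff
    (d : ℤ) (hd : Squarefree d) (hd0 : d ≠ 0) (hd1 : d ≠ 1)
    (K : Type*) [Field K] [NumberField K]
    (α : K) (hα : α ^ 2 = (d : K)) (hrank : Module.finrank ℚ K = 2)
    (Δ : ℤ) (hΔ : (d % 4 = 1 ∧ Δ = d) ∨ (d % 4 ≠ 1 ∧ Δ = 4 * d))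
    (p : ℕ) [Fact p.Prime] (hp2 : p ≠ 2)
    (𝔭 : Ideal (𝓞 K)) [𝔭.IsPrime] (h𝔭 : 𝔭 ≠ ⊥)
    (hcomap : Ideal.comap (algebraMap ℤ (𝓞 K)) 𝔭 = Ideal.span {(p : ℤ)})
    (G : Type*) [CommGroup G] [Fintype G] [Nontrivial G]
    (n : ℕ) (hn : Monoid.exponent G = n) (hpn : ¬ p ∣ n)
    (hΔn : ¬ Δ ∣ (n : ℤ)) :
    ((IsFeeblyCleanRing (MonoidAlgebra (Localization.AtPrime 𝔭) G) ∧
        ¬ IsCleanRing (MonoidAlgebra (Localization.AtPrime 𝔭) G)) ↔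
      (IsFeeblyCleanRing (Polynomial (Localization.AtPrime 𝔭) ⧸
          Ideal.span {Polynomial.cyclotomic n (Localization.AtPrime 𝔭)}) ∧
        ¬ IsCleanRing (Polynomial (Localization.AtPrime 𝔭) ⧸
          Ideal.span {Polynomial.cyclotomic n (Localization.AtPrime 𝔭)}))) ∧
    ((IsFeeblyCleanRing (MonoidAlgebra (Localization.AtPrime 𝔭) G) ∧
        ¬ IsCleanRing (MonoidAlgebra (Localization.AtPrime 𝔭) G)) ↔
      -- (a)
      ((Nat.totient n = 2 * orderOf ((p : ZMod n)) ∧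
          (legendreSym p Δ = 1 ∨ legendreSym p Δ = 0)) ∨
      -- (b)
        (2 * orderOf ((p : ZMod n)) = Nat.totient n ∧ Odd (orderOf ((p : ZMod n))) ∧
          legendreSym p Δ = -1) ∨
      -- (c)
        (n ≠ 2 ∧ Nat.totient n = orderOf ((p : ZMod n)) ∧ legendreSym p Δ = -1))) := by
  have hp' : p.Prime := Fact.out
  have hexp0 : n ≠ 0 := by rw [← hn]; exact Monoid.exponent_ne_zero_of_finite
  have : NeZero n := ⟨hexp0⟩
  have hn1 : n ≠ 1 := by
    intro h
    rw [h, Monoid.exp_eq_one_iff] at hn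
    exact not_subsingleton G hn
  have hmemiff : ∀ m : ℤ, ((m : 𝓞 K) ∈ 𝔭 ↔ (p : ℤ) ∣ m) := by
    intro m
    rw [← Ideal.mem_span_singleton, ← hcomap, Ideal.mem_comap, eq_intCast]
  have hpmem : (p : 𝓞 K) ∈ 𝔭 := by
    have := (hmemiff p).2 (dvd_refl _)
    exact_mod_cast this
  have hunit : ∀ m : ℕ, ¬ p ∣ m → IsUnit (m : Localization.AtPrime 𝔭) := by
    intro m hm
    have h1 : (m : 𝓞 K) ∈ 𝔭.primeCompl := by
      intro h2
      have h3 := (hmemiff m).1 (by exact_mod_cast h2)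
      exact hm (by exact_mod_cast h3)
    have := IsLocalization.map_units (Localization.AtPrime 𝔭) (⟨_, h1⟩ : 𝔭.primeCompl)
    simpa using this
  have h2u : IsUnit (2 : Localization.AtPrime 𝔭) := by
    have := hunit 2 (fun h => hp2 ((Nat.prime_dvd_prime_iff_eq hp' Nat.prime_two).1 h))
    exact_mod_cast this
  have hGu : IsUnit (Nat.card G : Localization.AtPrime 𝔭) := by
    refine hunit _ fun h => hpn ?_
    obtain ⟨x, hx⟩ := exists_prime_orderOf_dvd_card' p h
    rw [← hn, ← hx]
    exact Monoid.order_dvd_exponent x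
  have hcop : p.Coprime n := hp'.coprime_iff_not_dvd.2 hpn
  have hdom : IsDomain (Polynomial (Localization.AtPrime 𝔭) ⧸
      Ideal.span {Polynomial.cyclotomic n (Localization.AtPrime 𝔭)}) :=
    isDomain_quot 𝔭 h𝔭 n (cyclotomic_irreducible_K d hd α hα hrank Δ hΔ n hΔn)
  have hint : IsIntegral ℤ α := by
    refine IsIntegral.of_pow (n := 2) (by norm_num) ?_
    rw [hα]
    exact isIntegral_algebraMap (R := ℤ) (x := d)
  have ha : (⟨α, hint⟩ : 𝓞 K) ^ 2 = (d : 𝓞 K) := RingOfIntegers.ext hα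
  have hleg : legendreSym p Δ = legendreSym p d := by
    rcases hΔ with ⟨-, rfl⟩ | ⟨-, rfl⟩
    · rfl
    · have h2 : ((2 : ℤ) : ZMod p) ≠ 0 := by
        rw [Ne, ZMod.intCast_zmod_eq_zero_iff_dvd]
        intro h
        have h' : p ∣ 2 := by exact_mod_cast h
        exact hp2 ((Nat.prime_dvd_prime_iff_eq hp' Nat.prime_two).1 h')
      rw [legendreSym.mul, show (4 : ℤ) = 2 ^ 2 by norm_num, legendreSym.sq_one' p h2, one_mul]
  have hcardR := card_residue 𝔭 h𝔭
  have hcases := absNorm_cases hrank p 𝔭 hpmem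
  have hfin : Finite (IsLocalRing.ResidueField (Localization.AtPrime 𝔭)) := by
    refine Nat.finite_of_card_ne_zero ?_
    rw [hcardR]
    rcases hcases with h | h <;> rw [h]
    · exact hp'.ne_zero
    · exact pow_ne_zero _ hp'.ne_zero
  let _ : Fintype (IsLocalRing.ResidueField (Localization.AtPrime 𝔭)) := Fintype.ofFinite _
  rw [Nat.card_eq_fintype_card] at hcardR
  have hord : 0 < orderOf (p : ZMod n) := by
    rw [← ZMod.coe_unitOfCoprime p hcop, orderOf_units]
    exact orderOf_pos _
  rw [hleg]
  by_cases hs : IsSquare (d : ZMod p)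
  · have hl : legendreSym p d ≠ -1 := fun h => (legendreSym.eq_neg_one_iff p).1 h hs
    have hl' : legendreSym p d = 1 ∨ legendreSym p d = 0 := by
      by_cases h0 : (d : ZMod p) = 0
      · right; exact (legendreSym.eq_zero_iff p d).2 h0
      · left; exact (legendreSym.eq_one_or_neg_one p h0).resolve_right hl
    have hk : Fintype.card (IsLocalRing.ResidueField (Localization.AtPrime 𝔭)) = p ^ 1 := by
      rw [hcardR, pow_one]
      exact hcases.resolve_right (absNorm_ne_sq hrank d hd hd1 _ ha p hp2 𝔭 hpmem hs)
    obtain ⟨c1, c2⟩ := core n hn hk hcop (hunit n hpn) hGu h2u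
    refine ⟨c1, c2.trans ?_⟩
    rw [pow_one]
    constructor
    · intro h
      exact Or.inl ⟨h, hl'⟩
    · rintro (⟨h, -⟩ | ⟨-, -, h⟩ | ⟨-, -, h⟩)
      · exact h
      · exact absurd h hl
      · exact absurd h hl
  · have hl : legendreSym p d = -1 := (legendreSym.eq_neg_one_iff p).2 hs
    have hk : Fintype.card (IsLocalRing.ResidueField (Localization.AtPrime 𝔭)) = p ^ 2 := by
      rw [hcardR]
      exact hcases.resolve_left fun h => hs (isSquare_of_absNorm d _ ha p 𝔭 hpmem h)
    obtain ⟨c1, c2⟩ := core n hn hk hcop (hunit n hpn) hGu h2u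
    refine ⟨c1, c2.trans ?_⟩
    rw [orderOf_pow' _ two_ne_zero, hl]
    have hphi : n ≠ 2 → Even n.totient := fun h => Nat.totient_even (by omega)
    have hphi2 : n = 2 → n.totient = 1 := fun h => by rw [h]; rfl
    generalize n.totient = t at hphi hphi2 ⊢
    generalize orderOf (p : ZMod n) = o at hord ⊢
    rcases Nat.even_or_odd o with ho | ho
    · have hg : Nat.gcd o 2 = 2 := Nat.gcd_eq_right ho.two_dvd
      have ho' : ¬ Odd o := Nat.not_odd_iff_even.2 ho
      rw [hg]
      have : 2 * (o / 2) = o := Nat.mul_div_cancel' ho.two_dvd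
      rw [this]
      constructor
      · intro h
        refine Or.inr (Or.inr ⟨fun h2 => ?_, h, rfl⟩)
        have := hphi2 h2
        obtain ⟨r, hr⟩ := ho
        omega
      · rintro (⟨-, h | h⟩ | ⟨-, h, -⟩ | ⟨-, h, -⟩)
        · exact absurd h (by norm_num)
        · exact absurd h (by norm_num)
        · exact absurd h ho'
        · exact h
    · have hg : Nat.gcd o 2 = 1 := Nat.coprime_two_right.2 ho
      rw [hg, Nat.div_one]
      constructor
      · intro h
        exact Or.inr (Or.inl ⟨h.symm, ho, rfl⟩)
      · rintro (⟨-, h | h⟩ | ⟨h, -, -⟩ | ⟨h2, h, -⟩)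
        · exact absurd h (by norm_num)
        · exact absurd h (by norm_num)
        · exact h.symm
        · exact absurd (h ▸ hphi h2) (Nat.not_even_iff_odd.2 ho)
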